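/- Let α > 0 with α ≠ 1, let γ satisfy 0 < γ < min(1, α), let u_0 ∈ ℝ, let N ∈ ℤ, and let f : {p^k : k ∈ ℤ} × ℝ → ℝ satisfy |f(p^ℓ, x)| ≤ M for all ℓ ∈ ℤ, x ∈ ℝ. Suppose u is a radial function satisfying u(|t|_p) = u_0 + (I^α [ f̃(|·|_p, u(|·|_p)) ])(|t|_p) for all nonzero t with |t|_p ≤ p^{N+1}. Then the value u(p^{N+1}) satisfies the fixed-point equation u(p^{N+1}) = u_0 + v_0^{(N)} + p^{αN} f̃(p^{N+1}, u(p^{N+1})), where v_0^{(N)} = ((1 − p^{−α})/(1 − p^{α−1})) ∫_{|y|_p ≤ p^N} ( p^{(N+1)(α−1)} − |y|_p^{α−1} ) f̃(|y|_p, u(|y|_p)) dy. -/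

import Mathlib

open MeasureTheory Metric

noncomputable section

variable (p : ℕ) [Fact p.Prime]

instance : MeasurableSpace ℚ_[p] := borel _
instance : BorelSpace ℚ_[p] := ⟨rfl⟩

/-- The closed unit ball of `ℚ_[p]` as a positive compact set. -/
def unitBallPC : TopologicalSpace.PositiveCompacts ℚ_[p] where
  carrier := closedBall 0 1
  isCompact' := isCompact_closedBall 0 1
  interior_nonempty' := ⟨0, mem_interior_iff_mem_nhds.2
    (Filter.mem_of_superset (ball_mem_nhds 0 one_pos) ball_subset_closedBall)⟩

/-- The Haar measure on `ℚ_[p]` normalized so the unit ball has measure 1. -/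
def padicHaar : Measure ℚ_[p] := Measure.addHaarMeasure (unitBallPC p)

/-- A point on the sphere of radius `p^k`. -/
def sph (k : ℤ) : ℚ_[p] := (p : ℚ_[p]) ^ (-k)

/-- A function is radial if it depends only on the p-adic absolute value. -/
def Radial (u : ℚ_[p] → ℝ) : Prop := ∀ x y : ℚ_[p], ‖x‖ = ‖y‖ → u x = u y

/-- The integrand of the Vladimirov operator `D^α` at `x`. -/
def Dker (α : ℝ) (u : ℚ_[p] → ℝ) (x : ℚ_[p]) : ℚ_[p] → ℝ :=
  fun y => ‖y‖ ^ (-α - 1) * (u (x - y) - u x)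

/-- The Vladimirov fractional differentiation operator. -/
def Dop (α : ℝ) (u : ℚ_[p] → ℝ) (x : ℚ_[p]) : ℝ :=
  ((1 - (p : ℝ) ^ α) / (1 - (p : ℝ) ^ (-α - 1))) * ∫ y, Dker p α u x y ∂(padicHaar p)

/-- The kernel of the fractional integral `I^α`. -/
def Iker (α : ℝ) (x y : ℚ_[p]) : ℝ :=
  if α = 1 then Real.log ‖x - y‖ - Real.log ‖y‖
  else ‖x - y‖ ^ (α - 1) - ‖y‖ ^ (α - 1)

/-- The constant in front of the fractional integral. -/
def Icoef (α : ℝ) : ℝ :=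
  if α = 1 then (1 - (p : ℝ)) / (p * Real.log p)
  else (1 - (p : ℝ) ^ (-α)) / (1 - (p : ℝ) ^ (α - 1))

/-- The p-adic fractional integral `I^α`. -/
def Iop (α : ℝ) (u : ℚ_[p] → ℝ) (x : ℚ_[p]) : ℝ :=
  Icoef p α * ∫ y in {y : ℚ_[p] | ‖y‖ ≤ ‖x‖}, Iker p α x y * u y ∂(padicHaar p)

end


section helpers

variable (p : ℕ) [Fact p.Prime]

instance : (padicHaar p).IsAddHaarMeasure := by unfold padicHaar; infer_instance

/-- closed ball of radius `p^k` -/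
def BB (k : ℤ) : Set ℚ_[p] := {y | ‖y‖ ≤ (p : ℝ) ^ k}

/-- sphere of radius `p^k` -/
def SS (k : ℤ) : Set ℚ_[p] := {y | ‖y‖ = (p : ℝ) ^ k}

lemma p_pos' : (0 : ℝ) < p := by exact_mod_cast (Fact.out : p.Prime).pos
lemma p_one' : (1 : ℝ) < p := by exact_mod_cast (Fact.out : p.Prime).one_lt

lemma measBB (k : ℤ) : MeasurableSet (BB p k) :=
  measurableSet_le continuous_norm.measurable measurable_const

lemma measSS (k : ℤ) : MeasurableSet (SS p k) :=
  measurableSet_eq_fun continuous_norm.measurable measurable_const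

lemma BB_eq (k : ℤ) : BB p k = closedBall 0 ((p : ℝ) ^ k) := by
  ext y; simp [BB]

lemma BB_fin (k : ℤ) : padicHaar p (BB p k) ≠ ⊤ := by
  rw [BB_eq]; exact (isCompact_closedBall _ _).measure_lt_top.ne

lemma norm_sph (k : ℤ) : ‖sph p k‖ = (p : ℝ) ^ k := by
  simp [sph]

lemma sph_ne (k : ℤ) : sph p k ≠ 0 := by
  rw [← norm_pos_iff, norm_sph]; exact zpow_pos (p_pos' p) _

lemma BB_succ_eq (k : ℤ) : BB p (k + 1) = ⋃ i ∈ Finset.range p,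
    (fun y => -((i : ℚ_[p]) * sph p (k + 1)) + y) ⁻¹' BB p k := by
  have hp := p_pos' p
  ext y
  simp only [Set.mem_iUnion, Set.mem_preimage, Finset.mem_range, exists_prop]
  constructor
  · intro hy
    have h1 : ‖y / sph p (k + 1)‖ ≤ 1 := by
      rw [norm_div, norm_sph]
      exact (div_le_one (zpow_pos hp _)).2 hy
    obtain ⟨z, hz⟩ : ∃ z : ℤ_[p], (z : ℚ_[p]) = y / sph p (k + 1) := ⟨⟨_, h1⟩, rfl⟩
    obtain ⟨n, hn, hn'⟩ := PadicInt.exists_mem_range z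
    refine ⟨n, hn, ?_⟩
    rw [PadicInt.maximalIdeal_eq_span_p, Ideal.mem_span_singleton, ← PadicInt.norm_lt_one_iff_dvd]
      at hn'
    have h2 : ‖y / sph p (k + 1) - n‖ < 1 := by
      rw [PadicInt.norm_def, PadicInt.coe_sub, PadicInt.coe_natCast, hz] at hn'
      exact hn'
    change ‖_‖ ≤ _
    rw [Padic.norm_le_pow_iff_norm_lt_pow_add_one]
    have h3 : -((n : ℚ_[p]) * sph p (k + 1)) + y = (y / sph p (k + 1) - n) * sph p (k + 1) := by
      rw [sub_mul, div_mul_cancel₀ _ (sph_ne p (k + 1))]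
      ring
    rw [h3, norm_mul, norm_sph]
    exact mul_lt_of_lt_one_left (zpow_pos hp _) h2
  · rintro ⟨i, -, hi⟩
    have h4 : ‖((i : ℚ_[p]) * sph p (k + 1))‖ ≤ (p : ℝ) ^ (k + 1) := by
      rw [norm_mul, norm_sph]
      refine mul_le_of_le_one_left (zpow_pos hp _).le ?_
      exact_mod_cast Padic.norm_int_le_one (p := p) (i : ℤ)
    have h5 : ‖-((i : ℚ_[p]) * sph p (k + 1)) + y‖ ≤ (p : ℝ) ^ (k + 1) :=
      le_trans hi (zpow_le_zpow_right₀ (p_one' p).le (by lia))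
    have h6 : y = ((i : ℚ_[p]) * sph p (k + 1)) + (-((i : ℚ_[p]) * sph p (k + 1)) + y) := by ring
    change ‖y‖ ≤ _
    rw [h6]
    exact (Padic.nonarchimedean _ _).trans (max_le h4 h5)

lemma meas_BB_succ (k : ℤ) : padicHaar p (BB p (k + 1)) = p * padicHaar p (BB p k) := by
  have hp := p_pos' p
  rw [BB_succ_eq, measure_biUnion_finset]
  · simp only [measure_preimage_add]
    simp
  · intro i hi j hj hij
    rw [Function.onFun, Set.disjoint_left]
    intro y h1 h2
    have h1' : ‖-((i : ℚ_[p]) * sph p (k + 1)) + y‖ ≤ (p : ℝ) ^ k := h1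
    have h2' : ‖-((j : ℚ_[p]) * sph p (k + 1)) + y‖ ≤ (p : ℝ) ^ k := h2
    have h3 : ‖(((i : ℤ) - (j : ℤ) : ℤ) : ℚ_[p]) * sph p (k + 1)‖ ≤ (p : ℝ) ^ k := by
      have : (((i : ℤ) - (j : ℤ) : ℤ) : ℚ_[p]) * sph p (k + 1) =
        (-((j : ℚ_[p]) * sph p (k + 1)) + y) + -(-((i : ℚ_[p]) * sph p (k + 1)) + y) := by
        push_cast; ring
      rw [this]
      refine (Padic.nonarchimedean _ _).trans (max_le h2' ?_)
      rwa [norm_neg]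
    rw [Padic.norm_le_pow_iff_norm_lt_pow_add_one, norm_mul, norm_sph] at h3
    have h4 : ‖(((i : ℤ) - (j : ℤ) : ℤ) : ℚ_[p])‖ < 1 := by
      have := zpow_pos hp (k + 1)
      by_contra hc
      push Not at hc
      nlinarith
    rw [Padic.norm_intCast_lt_one_iff] at h4
    simp only [Finset.coe_range, Set.mem_Iio] at hi hj
    apply hij
    have := Int.eq_zero_of_abs_lt_dvd h4 (by rw [abs_lt]; constructor <;> lia)
    lia
  · intro i _
    exact (measBB p k).preimage (measurable_const_add _)

lemma real_BB_succ (k : ℤ) : (padicHaar p).real (BB p (k + 1)) = p * (padicHaar p).real (BB p k) := by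
  simp [Measure.real, meas_BB_succ]

lemma real_BB (k : ℤ) : (padicHaar p).real (BB p k) = (p : ℝ) ^ k := by
  have hp := (p_pos' p).ne'
  induction k using Int.induction_on with
  | zero =>
    have : BB p 0 = unitBallPC p := by rw [BB_eq, zpow_zero]; rfl
    rw [this, Measure.real, padicHaar, Measure.addHaarMeasure_self]; simp
  | succ i ih => rw [real_BB_succ, ih, zpow_add_one₀ hp]; ring
  | pred i ih =>
    have := real_BB_succ p (-(i : ℤ) - 1)
    rw [sub_add_cancel, ih] at this
    rw [zpow_sub_one₀ hp, this]
    field_simp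

lemma BB_split (k : ℤ) : BB p (k + 1) = BB p k ∪ SS p (k + 1) := by
  ext y
  simp only [BB, SS, Set.mem_union, Set.mem_ofPred_eq]
  rw [Padic.norm_le_pow_iff_norm_lt_pow_add_one y k, le_iff_lt_or_eq]

lemma BB_disj (k : ℤ) : Disjoint (BB p k) (SS p (k + 1)) := by
  rw [Set.disjoint_left]
  intro y h1 h2
  have h1' : ‖y‖ ≤ (p : ℝ) ^ k := h1
  rw [Padic.norm_le_pow_iff_norm_lt_pow_add_one] at h1'
  exact h1'.ne h2

lemma SS_fin (k : ℤ) : padicHaar p (SS p k) ≠ ⊤ := by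
  refine ne_top_of_le_ne_top (BB_fin p k) (measure_mono ?_)
  intro y hy; exact le_of_eq hy

lemma real_SS (k : ℤ) : (padicHaar p).real (SS p (k + 1)) = (p : ℝ) ^ (k + 1) - (p : ℝ) ^ k := by
  have h := measureReal_union (μ := padicHaar p) (BB_disj p k) (measSS p (k + 1))
    (BB_fin p k) (SS_fin p _)
  rw [← BB_split, real_BB, real_BB] at h
  linarith

lemma pow_int_SS (β : ℝ) (k : ℤ) :
    ∫ y in SS p k, ‖y‖ ^ β ∂(padicHaar p) = (p : ℝ) ^ (β * k) * (padicHaar p).real (SS p k) := by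
  have : ∫ y in SS p k, ‖y‖ ^ β ∂(padicHaar p) = ∫ y in SS p k, (p : ℝ) ^ (β * k) ∂(padicHaar p) := by
    refine setIntegral_congr_fun (measSS p k) fun y hy => ?_
    have hy' : ‖y‖ = (p : ℝ) ^ k := hy
    simp only [hy']
    rw [← Real.rpow_intCast, ← Real.rpow_mul (p_pos' p).le, mul_comm]
  rw [this, setIntegral_const, smul_eq_mul, mul_comm]

lemma BB_diff (k : ℤ) : BB p k \ {0} = ⋃ n : ℕ, SS p (k - n) := by
  ext y
  simp only [Set.mem_sdiff, Set.mem_singleton_iff, Set.mem_iUnion]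
  constructor
  · rintro ⟨h1, h2⟩
    have h1' : ‖y‖ ≤ (p : ℝ) ^ k := h1
    rw [Padic.norm_eq_zpow_neg_valuation h2, zpow_le_zpow_iff_right₀ (p_one' p)] at h1'
    refine ⟨(k + y.valuation).toNat, ?_⟩
    change ‖y‖ = _
    rw [Padic.norm_eq_zpow_neg_valuation h2]
    congr 1
    lia
  · rintro ⟨n, hn⟩
    have hn' : ‖y‖ = (p : ℝ) ^ (k - n) := hn
    refine ⟨?_, ?_⟩
    · change ‖y‖ ≤ _
      rw [hn']
      exact zpow_le_zpow_right₀ (p_one' p).le (by lia)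
    · change y ≠ 0
      rw [← norm_pos_iff, hn']; exact zpow_pos (p_pos' p) _

lemma pow_int_BB (α : ℝ) (hα : 0 < α) (hα1 : α ≠ 1) (k : ℤ) :
    IntegrableOn (fun y : ℚ_[p] => ‖y‖ ^ (α - 1)) (BB p k) (padicHaar p) ∧
    ∫ y in BB p k, ‖y‖ ^ (α - 1) ∂(padicHaar p) =
      (1 - (p : ℝ)⁻¹) * (p : ℝ) ^ (α * k) / (1 - (p : ℝ) ^ (-α)) := by
  have hp := p_pos' p
  have hterm : ∀ n : ℕ, ∫ y in SS p (k - n), ‖y‖ ^ (α - 1) ∂(padicHaar p) =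
      ((1 - (p : ℝ)⁻¹) * (p : ℝ) ^ (α * k)) * ((p : ℝ) ^ (-α)) ^ n := by
    intro n
    have h1 := real_SS p (k - n - 1)
    rw [sub_add_cancel] at h1
    rw [pow_int_SS, h1, zpow_sub_one₀ hp.ne', ← Real.rpow_intCast, ← Real.rpow_natCast,
      ← Real.rpow_mul hp.le]
    have : (p : ℝ) ^ (α * k) * (p : ℝ) ^ (-α * n) =
        (p : ℝ) ^ ((α - 1) * ((k - n : ℤ) : ℝ)) * (p : ℝ) ^ ((k - n : ℤ) : ℝ) := by
      rw [← Real.rpow_add hp, ← Real.rpow_add hp]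
      congr 1
      push_cast
      ring
    linear_combination (-(1 - (p : ℝ)⁻¹)) * this
  have hq1 : (p : ℝ) ^ (-α) < 1 := Real.rpow_lt_one_of_one_lt_of_neg (p_one' p) (by linarith)
  have hq0 : 0 ≤ (p : ℝ) ^ (-α) := (Real.rpow_pos_of_pos hp _).le
  have hsum := (hasSum_geometric_of_lt_one hq0 hq1).mul_left ((1 - (p : ℝ)⁻¹) * (p : ℝ) ^ (α * k))
  have hintS : ∀ n : ℕ, IntegrableOn (fun y : ℚ_[p] => ‖y‖ ^ (α - 1)) (SS p (k - n))
      (padicHaar p) := by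
    intro n
    refine (integrableOn_const (C := ((p : ℝ) ^ (k - n : ℤ)) ^ (α - 1)) (SS_fin p (k - n))).congr_fun
      (fun y hy => ?_) (measSS p _)
    have hy' : ‖y‖ = (p : ℝ) ^ (k - n : ℤ) := hy
    simp only [hy']
  have hU : IntegrableOn (fun y : ℚ_[p] => ‖y‖ ^ (α - 1)) (⋃ n : ℕ, SS p (k - n))
      (padicHaar p) := by
    refine integrableOn_iUnion_of_summable_integral_norm hintS ?_
    have : ∀ n : ℕ, ∫ y in SS p (k - n), ‖‖y‖ ^ (α - 1)‖ ∂(padicHaar p) =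
        ((1 - (p : ℝ)⁻¹) * (p : ℝ) ^ (α * k)) * ((p : ℝ) ^ (-α)) ^ n := by
      intro n
      rw [← hterm]
      congr 1
      ext y
      exact Real.norm_of_nonneg (Real.rpow_nonneg (norm_nonneg _) _)
    simp_rw [this]
    exact hsum.summable
  have hval := integral_iUnion (fun n : ℕ => measSS p (k - n)) (by
    intro i j hij
    rw [Function.onFun, Set.disjoint_left]
    intro y h1 h2
    have h3 : (p : ℝ) ^ (k - i : ℤ) = (p : ℝ) ^ (k - j : ℤ) := Eq.trans (Eq.symm h1) h2
    have := zpow_right_injective₀ hp (p_one' p).ne' h3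
    lia) hU
  simp_rw [hterm] at hval
  rw [hsum.tsum_eq, ← BB_diff] at hval
  rw [← BB_diff] at hU
  have h0 : (0 : ℝ) ^ (α - 1) = 0 := Real.zero_rpow (sub_ne_zero.2 hα1)
  have hz : ∀ y ∈ BB p k \ (BB p k \ {0}), ‖y‖ ^ (α - 1) = 0 := by
    rintro y ⟨h1, h2⟩
    have : y = 0 := by
      by_contra hc
      exact h2 ⟨h1, hc⟩
    rw [this, norm_zero, h0]
  constructor
  · exact hU.of_forall_sdiff_eq_zero (measBB p k) hz
  · have hE := setIntegral_eq_of_subset_of_forall_sdiff_eq_zero (μ := padicHaar p)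
      (f := fun y : ℚ_[p] => ‖y‖ ^ (α - 1)) (measBB p k) Set.sdiff_subset hz
    rw [hE, hval]
    rfl

lemma norm_sub_of_mem (N : ℤ) (t y : ℚ_[p]) (ht : ‖t‖ = (p : ℝ) ^ (N + 1)) (hy : y ∈ BB p N) :
    ‖t - y‖ = (p : ℝ) ^ (N + 1) := by
  have hy' : ‖y‖ ≤ (p : ℝ) ^ N := hy
  rw [Padic.norm_le_pow_iff_norm_lt_pow_add_one, ← ht] at hy'
  have := Padic.norm_eq_of_norm_sub_lt_left (p := p) (z1 := t) (z2 := t - y) (by simpa using hy')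
  rw [← this, ht]

lemma shift_int (α : ℝ) (hα : 0 < α) (hα1 : α ≠ 1) (N : ℤ) (t : ℚ_[p])
    (ht : ‖t‖ = (p : ℝ) ^ (N + 1)) :
    IntegrableOn (fun y : ℚ_[p] => ‖t - y‖ ^ (α - 1)) (BB p (N + 1)) (padicHaar p) ∧
    ∫ y in BB p (N + 1), ‖t - y‖ ^ (α - 1) ∂(padicHaar p) =
      (1 - (p : ℝ)⁻¹) * (p : ℝ) ^ (α * (N + 1 : ℤ)) / (1 - (p : ℝ) ^ (-α)) := by
  obtain ⟨h1, h2⟩ := pow_int_BB p α hα hα1 (N + 1)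
  have hmem : ∀ y, t - y ∈ BB p (N + 1) ↔ y ∈ BB p (N + 1) := by
    have aux : ∀ y, y ∈ BB p (N + 1) → t - y ∈ BB p (N + 1) := by
      intro y hy
      change ‖t - y‖ ≤ _
      rw [sub_eq_add_neg]
      refine (Padic.nonarchimedean _ _).trans (max_le ht.le ?_)
      rw [norm_neg]; exact hy
    refine fun y => ⟨fun h => ?_, aux y⟩
    simpa using aux _ h
  have hind : (fun y => (BB p (N + 1)).indicator (fun y : ℚ_[p] => ‖y‖ ^ (α - 1)) (t - y)) =
      (BB p (N + 1)).indicator (fun y : ℚ_[p] => ‖t - y‖ ^ (α - 1)) := by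
    ext y
    by_cases hy : y ∈ BB p (N + 1)
    · rw [Set.indicator_of_mem hy, Set.indicator_of_mem ((hmem y).2 hy)]
    · rw [Set.indicator_of_notMem hy, Set.indicator_of_notMem (fun h => hy ((hmem y).1 h))]
  constructor
  · rw [← integrable_indicator_iff (measBB p _)] at h1 ⊢
    rw [← hind]
    exact h1.comp_sub_left t
  · rw [← h2, ← integral_indicator (measBB p _), ← integral_indicator (measBB p _), ← hind]
    exact integral_sub_left_eq_self _ _ t

lemma sphere_int (α : ℝ) (hα : 0 < α) (hα1 : α ≠ 1) (N : ℤ) (t : ℚ_[p])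
    (ht : ‖t‖ = (p : ℝ) ^ (N + 1)) :
    ((1 - (p : ℝ) ^ (-α)) / (1 - (p : ℝ) ^ (α - 1))) *
    ∫ y in SS p (N + 1), (‖t - y‖ ^ (α - 1) - ‖y‖ ^ (α - 1)) ∂(padicHaar p) =
      (p : ℝ) ^ (α * N) := by
  have hp := p_pos' p
  obtain ⟨h1, h2⟩ := shift_int p α hα hα1 N t ht
  obtain ⟨h3, -⟩ := pow_int_BB p α hα hα1 (N + 1)
  have hR : ((p : ℝ) ^ (N + 1)) ^ (α - 1) = (p : ℝ) ^ ((α - 1) * (N + 1 : ℤ)) := by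
    rw [← Real.rpow_intCast, ← Real.rpow_mul hp.le, mul_comm]
  rw [BB_split] at h1 h3
  rw [BB_split, setIntegral_union (BB_disj p N) (measSS p _) h1.left_of_union h1.right_of_union] at h2
  have h4 : ∫ y in BB p N, ‖t - y‖ ^ (α - 1) ∂(padicHaar p) =
      (p : ℝ) ^ ((α - 1) * (N + 1 : ℤ)) * (p : ℝ) ^ N := by
    rw [setIntegral_congr_fun (g := fun _ => (p : ℝ) ^ ((α - 1) * (N + 1 : ℤ))) (measBB p N),
      setIntegral_const, smul_eq_mul, mul_comm, real_BB]
    intro y hy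
    simp only [norm_sub_of_mem p N t y ht hy, hR]
  rw [integral_sub h1.right_of_union h3.right_of_union, pow_int_SS, real_SS]
  rw [h4] at h2
  have hq1 : (p : ℝ) ^ (-α) < 1 := Real.rpow_lt_one_of_one_lt_of_neg (p_one' p) (by linarith)
  have hq : 1 - (p : ℝ) ^ (-α) ≠ 0 := by linarith
  have hr : 1 - (p : ℝ) ^ (α - 1) ≠ 0 := by
    intro h
    have h' : (p : ℝ) ^ (α - 1) = 1 := by linarith
    replace h' := (Real.rpow_right_inj hp (p_one' p).ne').1 (h'.trans (Real.rpow_zero (p : ℝ)).symm)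
    exact hα1 (by linarith)
  -- express all powers through a = p^α and b = p^(αN)
  have e1 : (p : ℝ) ^ ((α - 1) * (N + 1 : ℤ)) * (p : ℝ) ^ N = (p : ℝ) ^ (α * N) * (p : ℝ) ^ (α - 1) := by
    rw [← Real.rpow_intCast, ← Real.rpow_add hp, ← Real.rpow_add hp]
    congr 1; push_cast; ring
  have e2 : (p : ℝ) ^ (α * (N + 1 : ℤ)) = (p : ℝ) ^ (α * N) * (p : ℝ) ^ α := by
    rw [← Real.rpow_add hp]
    congr 1; push_cast; ring
  have e3 : (p : ℝ) ^ (α - 1) = (p : ℝ) ^ α / p := Real.rpow_sub_one hp.ne' α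
  have e4 : (p : ℝ) ^ (-α) = ((p : ℝ) ^ α)⁻¹ := Real.rpow_neg hp.le α
  have e5 : (p : ℝ) ^ (N + 1) = (p : ℝ) ^ N * p := zpow_add_one₀ hp.ne' N
  have ha : (p : ℝ) ^ α ≠ 0 := (Real.rpow_pos_of_pos hp _).ne'
  have h5 : ∫ y in SS p (N + 1), ‖t - y‖ ^ (α - 1) ∂(padicHaar p) =
      (1 - (p : ℝ)⁻¹) * ((p : ℝ) ^ (α * N) * (p : ℝ) ^ α) / (1 - (p : ℝ) ^ (-α)) -
      (p : ℝ) ^ (α * N) * (p : ℝ) ^ (α - 1) := by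
    rw [← e1, ← e2]; linarith
  have h6 : (p : ℝ) ^ ((α - 1) * (N + 1 : ℤ)) * ((p : ℝ) ^ (N + 1) - (p : ℝ) ^ N) =
      (p : ℝ) ^ (α * N) * (p : ℝ) ^ (α - 1) * (p - 1) := by
    rw [e5, ← e1]; ring
  rw [h5, h6]
  rw [div_mul_eq_mul_div, div_eq_iff hr, mul_sub, mul_sub, mul_div_cancel₀ _ hq, e3, e4]
  field_simp
  ring

end helpers

/-- the fixed-point equation for the value of a mild solution on the next
sphere, `α ≠ 1`. -/
theorem next_sphere_fixed_point (p : ℕ) [Fact p.Prime] (α γ : ℝ)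
    (hα : 0 < α) (hα1 : α ≠ 1) (hγ0 : 0 < γ) (hγ : γ < min 1 α) (u₀ M : ℝ)
    (f : ℤ → ℝ → ℝ) (hM : ∀ (ℓ : ℤ) (x : ℝ), |f ℓ x| ≤ M) (N : ℤ)
    (u : ℚ_[p] → ℝ) (hu : Radial p u)
    (heq : ∀ t : ℚ_[p], t ≠ 0 → ‖t‖ ≤ (p : ℝ) ^ (N + 1) →
      IntegrableOn (fun y => Iker p α t y * (‖y‖ ^ (-γ) * f (-y.valuation) (u y)))
        {y : ℚ_[p] | ‖y‖ ≤ ‖t‖} (padicHaar p) ∧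
      u t = u₀ + Iop p α (fun y => ‖y‖ ^ (-γ) * f (-y.valuation) (u y)) t) :
    u (sph p (N + 1)) =
      u₀ +
        ((1 - (p : ℝ) ^ (-α)) / (1 - (p : ℝ) ^ (α - 1))) *
          ∫ y in {y : ℚ_[p] | ‖y‖ ≤ (p : ℝ) ^ N},
            ((p : ℝ) ^ (((N : ℝ) + 1) * (α - 1)) - ‖y‖ ^ (α - 1)) *
              (‖y‖ ^ (-γ) * f (-y.valuation) (u y)) ∂(padicHaar p) +
        (p : ℝ) ^ (α * (N : ℝ)) *
          ((p : ℝ) ^ (-γ * ((N : ℝ) + 1)) * f (N + 1) (u (sph p (N + 1)))) := by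
  have hp := p_pos' p
  have ht := norm_sph p (N + 1)
  obtain ⟨hint, hval⟩ := heq _ (sph_ne p (N + 1)) ht.le
  have hset : {y : ℚ_[p] | ‖y‖ ≤ ‖sph p (N + 1)‖} = BB p N ∪ SS p (N + 1) := by
    rw [← BB_split, ht]; rfl
  rw [hset] at hint
  have hcoef : Icoef p α = (1 - (p : ℝ) ^ (-α)) / (1 - (p : ℝ) ^ (α - 1)) := if_neg hα1
  have hker : ∀ y, Iker p α (sph p (N + 1)) y = ‖sph p (N + 1) - y‖ ^ (α - 1) - ‖y‖ ^ (α - 1) :=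
    fun y => if_neg hα1
  have hR : ∀ β : ℝ, ((p : ℝ) ^ (N + 1)) ^ β = (p : ℝ) ^ (((N : ℝ) + 1) * β) := by
    intro β
    rw [← Real.rpow_intCast, ← Real.rpow_mul hp.le]; push_cast; rfl
  have hA : ∫ y in BB p N, Iker p α (sph p (N + 1)) y * (‖y‖ ^ (-γ) * f (-y.valuation) (u y))
      ∂(padicHaar p) = ∫ y in {y : ℚ_[p] | ‖y‖ ≤ (p : ℝ) ^ N},
            ((p : ℝ) ^ (((N : ℝ) + 1) * (α - 1)) - ‖y‖ ^ (α - 1)) *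
              (‖y‖ ^ (-γ) * f (-y.valuation) (u y)) ∂(padicHaar p) := by
    refine setIntegral_congr_fun (measBB p N) fun y hy => ?_
    simp only [hker, norm_sub_of_mem p N _ y ht hy, hR]
  have hB : ∫ y in SS p (N + 1), Iker p α (sph p (N + 1)) y *
      (‖y‖ ^ (-γ) * f (-y.valuation) (u y)) ∂(padicHaar p) =
      (∫ y in SS p (N + 1), (‖sph p (N + 1) - y‖ ^ (α - 1) - ‖y‖ ^ (α - 1)) ∂(padicHaar p)) *
      ((p : ℝ) ^ (-γ * ((N : ℝ) + 1)) * f (N + 1) (u (sph p (N + 1)))) := by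
    rw [← integral_mul_const]
    refine setIntegral_congr_fun (measSS p _) fun y hy => ?_
    have hy' : ‖y‖ = (p : ℝ) ^ (N + 1) := hy
    have hy0 : y ≠ 0 := by
      rw [← norm_pos_iff, hy']; exact zpow_pos hp _
    have hv : -y.valuation = N + 1 := by
      rw [Padic.norm_eq_zpow_neg_valuation hy0] at hy'
      exact zpow_right_injective₀ hp (p_one' p).ne' hy'
    have huy : u y = u (sph p (N + 1)) := hu _ _ (by rw [hy', ht])
    simp only [hker, hv, huy, hy', hR]
    rw [mul_comm (-γ)]
  rw [Iop, hcoef, hset, setIntegral_union (BB_disj p N) (measSS p _) hint.left_of_union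
    hint.right_of_union, hA, hB, mul_add, ← mul_assoc _ (∫ y in SS p (N + 1), _ ∂_),
    sphere_int p α hα hα1 N _ ht, ← add_assoc] at hval
  exact hval
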